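/- Let P be a finite nonempty collection of cells and let [a,b] and [α,β] be inner intervals of P with a=(i,j), b=(k,l), c=(i,l), d=(k,j), α=b and β=(p,q)∉[a,b] (so p>k, q>l, γ=(k,q) and δ=(p,l)); set h=(p,j) and r=(i,q) (the anti-diagonal corners, different from b, of the intervals [d,δ] and [c,γ] respectively). Let <^P be a P-order such that gcd(in(f_{a,b}), in(f_{α,β}))≠1. Then S(f_{a,b},f_{α,β}) reduces to 0 modulo G with respect to <^P_lex if and only if one of the following holds: (1) x_a x_γ x_δ <^P_lex x_β x_d x_c, the set {d,δ,b,h} is the vertex set of an inner interval of P, and either both h <^P β and γ <^P β, or both h <^P d and γ <^P d; (2) x_a x_γ x_δ <^P_lex x_β x_d x_c, the set {c,γ,b,r} is the vertex set of an inner interval of P, and either both r <^P β and δ <^P β, or both r <^P c and δ <^P c; (3) x_β x_d x_c <^P_lex x_a x_γ x_δ, the set {c,γ,b,r} is the vertex set of an inner interval of P, and either both r <^P a and d <^P a, or both r <^P γ and d <^P γ; (4) x_β x_d x_c <^P_lex x_a x_γ x_δ, the set {d,δ,b,h} is the vertex set of an inner interval of P, and either both c <^P a and h <^P a, or both c <^P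 δ and h <^P δ. -/

import Mathlib

namespace ClosedPathPaper

open MvPolynomial

/-- Lattice points of `ℤ²`; a cell is identified with its lower left corner. -/
abbrev Pt : Type := ℤ × ℤ

/-- The four vertices (corners) of the unit cell with lower left corner `a`. -/
def cellVerts (a : Pt) : Set Pt :=
  {a, (a.1 + 1, a.2), (a.1, a.2 + 1), (a.1 + 1, a.2 + 1)}

/-- The vertex set `V(P)` of a collection of cells `P`. -/
def VP (P : Finset Pt) : Set Pt := ⋃ a ∈ P, cellVerts a

/-- `[a,b]` is a proper interval and every cell contained in it belongs to `P`. -/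
def IsInnerInterval (P : Finset Pt) (a b : Pt) : Prop :=
  a.1 < b.1 ∧ a.2 < b.2 ∧
    ∀ c : Pt, a.1 ≤ c.1 → c.1 < b.1 → a.2 ≤ c.2 → c.2 < b.2 → c ∈ P

/-- The four corners of the proper interval `[a,b]`:
diagonal corners `a, b` and anti-diagonal corners `c = (a.1, b.2)`, `d = (b.1, a.2)`. -/
def cornersOf (a b : Pt) : Finset Pt := {a, b, (a.1, b.2), (b.1, a.2)}

/-- The inner 2-minor `f_{a,b} = x_a x_b - x_c x_d` attached to the inner interval `[a,b]`. -/
noncomputable def innerMinor (K : Type*) [Field K] (a b : Pt) : MvPolynomial Pt K :=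
  X a * X b - X (a.1, b.2) * X (b.1, a.2)

/-- The set `G` of all inner 2-minors of `P`. -/
def minorsSet (K : Type*) [Field K] (P : Finset Pt) : Set (MvPolynomial Pt K) :=
  {f | ∃ a b : Pt, IsInnerInterval P a b ∧ f = innerMinor K a b}

/-- The polyomino ideal `I_P`. -/
noncomputable def polyoIdeal (K : Type*) [Field K] (P : Finset Pt) :
    Ideal (MvPolynomial Pt K) :=
  Ideal.span (minorsSet K P)

/-! ### Monomial orders -/

/-- Strict lexicographic comparison of exponent vectors induced by the
(strict total) order `po` on the variables. -/
def lexLt (po : Pt → Pt → Prop) (u v : Pt →₀ ℕ) : Prop :=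
  ∃ w : Pt, u w < v w ∧ ∀ w' : Pt, po w w' → u w' = v w'

def lexLe (po : Pt → Pt → Prop) (u v : Pt →₀ ℕ) : Prop := u = v ∨ lexLt po u v

/-- `m` is the leading monomial of `f` with respect to the lexicographic order
induced by `po`. -/
def IsLM {K : Type*} [Field K] (po : Pt → Pt → Prop) (f : MvPolynomial Pt K)
    (m : Pt →₀ ℕ) : Prop :=
  m ∈ f.support ∧ ∀ m' ∈ f.support, lexLe po m' m

/-- `sp` is the S-polynomial of `f` and `g` with respect to the lexicographic
order induced by `po`. -/
def IsSPoly {K : Type*} [Field K] (po : Pt → Pt → Prop) (f g sp : MvPolynomial Pt K) : Prop :=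
  ∃ mf mg : Pt →₀ ℕ, IsLM po f mf ∧ IsLM po g mg ∧
    sp = monomial (mf ⊔ mg - mf) (f.coeff mf)⁻¹ * f
       - monomial (mf ⊔ mg - mg) (g.coeff mg)⁻¹ * g

/-- `h` has a standard expression with respect to `G`, i.e. `h` reduces to `0`
modulo `G` with respect to the lexicographic order induced by `po`. -/
def ReducesToZero {K : Type*} [Field K] (po : Pt → Pt → Prop)
    (G : Set (MvPolynomial Pt K)) (h : MvPolynomial Pt K) : Prop :=
  ∃ (F : Finset (MvPolynomial Pt K)) (q : MvPolynomial Pt K → MvPolynomial Pt K),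
    ↑F ⊆ G ∧ h = ∑ g ∈ F, q g * g ∧
    ∀ g ∈ F, ∀ m, IsLM po (q g * g) m → ∃ mh, IsLM po h mh ∧ lexLe po m mh

/-- The exponent vector of `x_u x_v x_w`. -/
noncomputable def mono3 (u v w : Pt) : Pt →₀ ℕ :=
  Finsupp.single u 1 + Finsupp.single v 1 + Finsupp.single w 1

/-- The leading monomials, viewed as polynomials, of the members of `G`. -/
def leadingMonomials {K : Type*} [Field K] (po : Pt → Pt → Prop)
    (G : Set (MvPolynomial Pt K)) : Set (MvPolynomial Pt K) :=
  {f | ∃ g ∈ G, ∃ m, IsLM po g m ∧ f = monomial m (1 : K)}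

/-- The initial ideal of `I` with respect to the lexicographic order induced by `po`. -/
noncomputable def initialIdeal {K : Type*} [Field K] (po : Pt → Pt → Prop)
    (I : Ideal (MvPolynomial Pt K)) : Ideal (MvPolynomial Pt K) :=
  Ideal.span (leadingMonomials po (I : Set (MvPolynomial Pt K)))

/-- `G` is a Gröbner basis of `I`. -/
def IsGroebnerBasis {K : Type*} [Field K] (po : Pt → Pt → Prop)
    (G : Set (MvPolynomial Pt K)) (I : Ideal (MvPolynomial Pt K)) : Prop :=
  Ideal.span G = I ∧ Ideal.span (leadingMonomials po G) = initialIdeal po I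

/-- `G` is the reduced Gröbner basis of `I` (up to normalizing signs). -/
def IsReducedGroebnerBasis {K : Type*} [Field K] (po : Pt → Pt → Prop)
    (G : Set (MvPolynomial Pt K)) (I : Ideal (MvPolynomial Pt K)) : Prop :=
  IsGroebnerBasis po G I ∧
  (∀ g ∈ G, ∃ m, IsLM po g m ∧ (g.coeff m = 1 ∨ g.coeff m = -1)) ∧
  (∀ g ∈ G, ∀ g' ∈ G, g' ≠ g → ∀ m ∈ g.support, ∀ m', IsLM po g' m' → ¬ m' ≤ m)

/-! ### Closed paths and special configurations -/

/-- Two cells share a common edge. -/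
def cellAdj (a b : Pt) : Prop :=
  b = (a.1 + 1, a.2) ∨ b = (a.1 - 1, a.2) ∨ b = (a.1, a.2 + 1) ∨ b = (a.1, a.2 - 1)

/-- `P` is a closed path polyomino. -/
def IsClosedPath (P : Finset Pt) : Prop :=
  ∃ n : ℕ, 5 < n ∧ ∃ A : ZMod n → Pt,
    Function.Injective A ∧
    (∀ i, cellAdj (A i) (A (i + 1))) ∧
    (∀ i j : ZMod n, j ≠ i - 2 → j ≠ i - 1 → j ≠ i → j ≠ i + 1 → j ≠ i + 2 →
      cellVerts (A i) ∩ cellVerts (A j) = ∅) ∧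
    ∀ c : Pt, c ∈ P ↔ ∃ i, A i = c

/-- The horizontal block of rank `m` whose leftmost cell is `a`. -/
def hBlockCells (a : Pt) (m : ℕ) : Finset Pt :=
  (Finset.range m).image fun t : ℕ => (a.1 + (t : ℤ), a.2)

/-- The vertical block of rank `m` whose bottom cell is `a`. -/
def vBlockCells (a : Pt) (m : ℕ) : Finset Pt :=
  (Finset.range m).image fun t : ℕ => (a.1, a.2 + (t : ℤ))

/-- The vertex set of a finite set of cells. -/
def vertsOfCells (s : Finset Pt) : Set Pt := ⋃ c ∈ s, cellVerts c

/-- A W-pentomino of `P`: a horizontal block of rank two with leftmost cell `a₁`, a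
vertical block of rank two with bottom cell `a₂`, and a middle cell `A` not belonging to the
two blocks, such that the vertex sets of the two blocks meet exactly in the lower right
corner of `A`. -/
def IsWPentomino (P : Finset Pt) (a₁ a₂ A : Pt) : Prop :=
  hBlockCells a₁ 2 ⊆ P ∧ vBlockCells a₂ 2 ⊆ P ∧ A ∈ P ∧
  A ∉ hBlockCells a₁ 2 ∪ vBlockCells a₂ 2 ∧
  vertsOfCells (hBlockCells a₁ 2) ∩ vertsOfCells (vBlockCells a₂ 2) = {(A.1 + 1, A.2)}

/-- An RW-heptomino of `P`: a horizontal block of rank three with leftmost cell `a₁`, a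
vertical block of rank three with bottom cell `a₂`, and a middle cell `A` not belonging to
the two blocks, such that the vertex sets of the two blocks meet exactly in the upper left
corner of `A`. -/
def IsRWHeptomino (P : Finset Pt) (a₁ a₂ A : Pt) : Prop :=
  hBlockCells a₁ 3 ⊆ P ∧ vBlockCells a₂ 3 ⊆ P ∧ A ∈ P ∧
  A ∉ hBlockCells a₁ 3 ∪ vBlockCells a₂ 3 ∧
  vertsOfCells (hBlockCells a₁ 3) ∩ vertsOfCells (vBlockCells a₂ 3) = {(A.1, A.2 + 1)}

/-- An LD-horizontal skew tetromino of `P` (base point `p`): the cells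
`p, p+(1,0), p+(1,1), p+(2,1)`. -/
def IsLDhTetromino (P : Finset Pt) (p : Pt) : Prop :=
  p ∈ P ∧ (p.1 + 1, p.2) ∈ P ∧ (p.1 + 1, p.2 + 1) ∈ P ∧ (p.1 + 2, p.2 + 1) ∈ P

/-- An LD-vertical skew tetromino of `P` (base point `p`): the cells
`p, p+(0,1), p+(1,1), p+(1,2)`. -/
def IsLDvTetromino (P : Finset Pt) (p : Pt) : Prop :=
  p ∈ P ∧ (p.1, p.2 + 1) ∈ P ∧ (p.1 + 1, p.2 + 1) ∈ P ∧ (p.1 + 1, p.2 + 2) ∈ P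

/-- An LD-horizontal skew hexomino of `P` (base point `p`): the cells
`p, p+(1,0), p+(2,0), p+(2,1), p+(3,1), p+(4,1)`. -/
def IsLDhHexomino (P : Finset Pt) (p : Pt) : Prop :=
  p ∈ P ∧ (p.1 + 1, p.2) ∈ P ∧ (p.1 + 2, p.2) ∈ P ∧
  (p.1 + 2, p.2 + 1) ∈ P ∧ (p.1 + 3, p.2 + 1) ∈ P ∧ (p.1 + 4, p.2 + 1) ∈ P

/-- An LD-vertical skew hexomino of `P` (base point `p`): the cells
`p, p+(0,1), p+(0,2), p+(1,2), p+(1,3), p+(1,4)`. -/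
def IsLDvHexomino (P : Finset Pt) (p : Pt) : Prop :=
  p ∈ P ∧ (p.1, p.2 + 1) ∈ P ∧ (p.1, p.2 + 2) ∈ P ∧
  (p.1 + 1, p.2 + 2) ∈ P ∧ (p.1 + 1, p.2 + 3) ∈ P ∧ (p.1 + 1, p.2 + 4) ∈ P

/-- The total order `<¹` on `ℤ²`. -/
def lt1 (a b : Pt) : Prop := a.1 < b.1 ∨ (a.1 = b.1 ∧ a.2 < b.2)

/-- The P-order `<^Y` attached to a set `Y` of vertices. -/
def Ylt (Y : Set Pt) (a b : Pt) : Prop :=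
  (a ∉ Y ∧ b ∈ Y) ∨ (a ∉ Y ∧ b ∉ Y ∧ lt1 a b) ∨ (a ∈ Y ∧ b ∈ Y ∧ lt1 a b)


section helpers
variable {po : Pt → Pt → Prop}

lemma lexLt_add {u v : Pt →₀ ℕ} (w : Pt →₀ ℕ) (h : lexLt po u v) : lexLt po (u + w) (v + w) := by
  obtain ⟨x, hx, h⟩ := h
  exact ⟨x, by simpa using hx, fun y hy => by simp [h y hy]⟩

lemma lexLt_trans (hpo : IsStrictTotalOrder Pt po) {u v w : Pt →₀ ℕ} (h : lexLt po u v)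
    (h' : lexLt po v w) : lexLt po u w := by
  obtain ⟨x, hx, h⟩ := h
  obtain ⟨y, hy, h'⟩ := h'
  rcases trichotomous_of po x y with g | g | g
  · exact ⟨y, by rw [h y g]; exact hy, fun z hz => by rw [h z (trans_of po g hz), h' z hz]⟩
  · subst g
    exact ⟨x, hx.trans hy, fun z hz => by rw [h z hz, h' z hz]⟩
  · exact ⟨x, by rw [← h' x g]; exact hx, fun z hz => by rw [h z hz, h' z (trans_of po g hz)]⟩

lemma lexLt_irrefl (u : Pt →₀ ℕ) : ¬ lexLt po u u := by
  rintro ⟨x, hx, _⟩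
  exact lt_irrefl _ hx

lemma exists_max (hpo : IsStrictTotalOrder Pt po) (s : Finset Pt) (hs : s.Nonempty) :
    ∃ x ∈ s, ∀ y, po x y → y ∉ s := by
  classical
  induction hs using Finset.Nonempty.cons_induction with
  | singleton a =>
    refine ⟨a, by simp, fun y hy => ?_⟩
    simp only [Finset.mem_singleton]
    rintro rfl
    exact irrefl_of po _ hy
  | cons a s has hs ih =>
    obtain ⟨x, hx, ih⟩ := ih
    rcases trichotomous_of po x a with g | g | g
    · refine ⟨a, by simp, fun y hy => ?_⟩
      simp only [Finset.mem_cons, not_or]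
      refine ⟨?_, ih y (trans_of po g hy)⟩
      rintro rfl
      exact irrefl_of po _ hy
    · subst g
      exact absurd hx has
    · refine ⟨x, by simp [hx], fun y hy => ?_⟩
      simp only [Finset.mem_cons, not_or]
      refine ⟨?_, ih y hy⟩
      rintro rfl
      exact irrefl_of po _ (trans_of po g hy)

lemma lexLt_total (hpo : IsStrictTotalOrder Pt po) (u v : Pt →₀ ℕ) :
    lexLt po u v ∨ u = v ∨ lexLt po v u := by
  classical
  by_cases huv : u = v
  · exact Or.inr (Or.inl huv)
  let s := (u.support ∪ v.support).filter (fun x => u x ≠ v x)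
  have hmem : ∀ x, x ∉ s → u x = v x := by
    intro x hx
    by_contra hne
    apply hx
    simp only [s, Finset.mem_filter, Finset.mem_union, Finsupp.mem_support_iff]
    refine ⟨?_, hne⟩
    by_contra hcon
    push Not at hcon
    exact hne (hcon.1.trans hcon.2.symm)
  have hs : s.Nonempty := by
    by_contra hcon
    rw [Finset.not_nonempty_iff_eq_empty] at hcon
    exact huv (Finsupp.ext fun x => hmem x (by simp [hcon]))
  obtain ⟨x, hx, hmax⟩ := exists_max hpo s hs
  have hne : u x ≠ v x := (Finset.mem_filter.1 hx).2
  rcases lt_or_gt_of_ne hne with g | g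
  · exact Or.inl ⟨x, g, fun y hy => hmem y (hmax y hy)⟩
  · exact Or.inr (Or.inr ⟨x, g, fun y hy => (hmem y (hmax y hy)).symm⟩)

lemma lexLe_antisymm (hpo : IsStrictTotalOrder Pt po) {u v : Pt →₀ ℕ} (h : lexLe po u v)
    (h' : lexLe po v u) : u = v := by
  rcases h with h | h
  · exact h
  rcases h' with h' | h'
  · exact h'.symm
  exact absurd (lexLt_trans hpo h h') (lexLt_irrefl _)

lemma lexLe_add_add (hpo : IsStrictTotalOrder Pt po) {u v u' v' : Pt →₀ ℕ} (h : lexLe po u u')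
    (h' : lexLe po v v') : lexLe po (u + v) (u' + v') ∧ (u + v = u' + v' → u = u' ∧ v = v') := by
  rcases h with rfl | h
  · rcases h' with rfl | h'
    · exact ⟨Or.inl rfl, fun _ => ⟨rfl, rfl⟩⟩
    · refine ⟨Or.inr ?_, fun e => ⟨rfl, add_left_cancel e⟩⟩
      rw [add_comm u, add_comm u]; exact lexLt_add _ h'
  · have h1 : lexLt po (u + v) (u' + v) := lexLt_add _ h
    have h2 : lexLt po (u + v) (u' + v') := by
      rcases h' with rfl | h'
      · exact h1
      · refine lexLt_trans hpo h1 ?_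
        rw [add_comm u', add_comm u']; exact lexLt_add _ h'
    refine ⟨Or.inr h2, fun e => ?_⟩
    rw [e] at h2
    exact absurd h2 (lexLt_irrefl _)

variable {K : Type*} [Field K]

lemma isLM_unique (hpo : IsStrictTotalOrder Pt po) {f : MvPolynomial Pt K} {m m' : Pt →₀ ℕ}
    (h : IsLM po f m) (h' : IsLM po f m') : m = m' :=
  lexLe_antisymm hpo (h'.2 _ h.1) (h.2 _ h'.1)

lemma exists_lexmax (hpo : IsStrictTotalOrder Pt po) (s : Finset (Pt →₀ ℕ)) (hs : s.Nonempty) :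
    ∃ m ∈ s, ∀ m' ∈ s, lexLe po m' m := by
  classical
  induction hs using Finset.Nonempty.cons_induction with
  | singleton a => exact ⟨a, by simp, fun y hy => Or.inl (by simpa using hy)⟩
  | cons a s has hs ih =>
    obtain ⟨x, hx, ih⟩ := ih
    rcases lexLt_total hpo x a with g | g | g
    · refine ⟨a, by simp, fun y hy => ?_⟩
      rcases Finset.mem_cons.1 hy with rfl | hy
      · exact Or.inl rfl
      · rcases ih y hy with rfl | h
        · exact Or.inr g
        · exact Or.inr (lexLt_trans hpo h g)
    · subst g
      exact absurd hx has
    · refine ⟨x, by simp [hx], fun y hy => ?_⟩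
      rcases Finset.mem_cons.1 hy with rfl | hy
      · exact Or.inr g
      · exact ih y hy

lemma exists_isLM (hpo : IsStrictTotalOrder Pt po) {f : MvPolynomial Pt K} (hf : f ≠ 0) :
    ∃ m, IsLM po f m :=
  exists_lexmax hpo f.support (by rwa [Finset.nonempty_iff_ne_empty, Ne, support_eq_empty])

lemma isLM_mul (hpo : IsStrictTotalOrder Pt po) {f g : MvPolynomial Pt K} {m n : Pt →₀ ℕ}
    (hf : IsLM po f m) (hg : IsLM po g n) : IsLM po (f * g) (m + n) := by
  classical
  constructor
  · rw [mem_support_iff, coeff_mul, Finset.sum_eq_single (m, n)]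
    · exact mul_ne_zero (mem_support_iff.1 hf.1) (mem_support_iff.1 hg.1)
    · rintro ⟨x, y⟩ hxy hne
      rw [Finset.HasAntidiagonal.mem_antidiagonal] at hxy
      by_contra hcon
      have h1 := hf.2 x (mem_support_iff.2 (left_ne_zero_of_mul hcon))
      have h2 := hg.2 y (mem_support_iff.2 (right_ne_zero_of_mul hcon))
      obtain ⟨rfl, rfl⟩ := (lexLe_add_add hpo h1 h2).2 hxy
      exact hne rfl
    · intro h
      exact absurd (by rw [Finset.HasAntidiagonal.mem_antidiagonal]) h
  · intro m' hm'
    obtain ⟨x, hx, y, hy, rfl⟩ := Finset.mem_add.1 (support_mul f g hm')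
    exact (lexLe_add_add hpo (hf.2 x hx) (hg.2 y hy)).1

/-- necessity core -/
lemma exists_div (hpo : IsStrictTotalOrder Pt po) {G : Set (MvPolynomial Pt K)}
    {S : MvPolynomial Pt K} {B : Pt →₀ ℕ} (hB : IsLM po S B) (hS : ReducesToZero po G S) :
    ∃ g ∈ G, ∃ m, IsLM po g m ∧ m ≤ B := by
  obtain ⟨F, q, hF, hsum, hle⟩ := hS
  have h1 := mem_support_iff.1 hB.1
  rw [hsum, coeff_sum] at h1
  obtain ⟨g, hg, hne⟩ := Finset.exists_ne_zero_of_sum_ne_zero h1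
  have hmem : B ∈ (q g * g).support := mem_support_iff.2 hne
  have hne0 : q g * g ≠ 0 := by
    intro h0; rw [h0] at hne; simp at hne
  obtain ⟨u, hu⟩ := exists_isLM hpo (left_ne_zero_of_mul hne0)
  obtain ⟨v, hv⟩ := exists_isLM hpo (right_ne_zero_of_mul hne0)
  have huv := isLM_mul hpo hu hv
  obtain ⟨mh, hmh, hl⟩ := hle g hg _ huv
  have := isLM_unique hpo hmh hB
  subst this
  have e := lexLe_antisymm hpo hl (huv.2 _ hmem)
  exact ⟨g, hF hg, v, hv, by rw [← e]; exact le_add_self⟩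

/-- sufficiency core -/
lemma reduces_of {G : Set (MvPolynomial Pt K)}
    {S g₁ g₂ q₁ q₂ : MvPolynomial Pt K} {B : Pt →₀ ℕ} (hB : IsLM po S B)
    (hg₁ : g₁ ∈ G) (hg₂ : g₂ ∈ G) (hS : S = q₁ * g₁ - q₂ * g₂)
    (h₁ : ∀ m ∈ (q₁ * g₁).support, lexLe po m B) (h₂ : ∀ m ∈ (q₂ * g₂).support, lexLe po m B) :
    ReducesToZero po G S := by
  classical
  by_cases e : g₁ = g₂
  · subst e
    refine ⟨{g₁}, fun _ => q₁ - q₂, by simpa using hg₁, by rw [hS]; simp [sub_mul], ?_⟩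
    intro g hg m hm
    rw [Finset.mem_singleton.1 hg, sub_mul, ← hS] at hm
    exact ⟨m, hm, Or.inl rfl⟩
  · refine ⟨{g₁, g₂}, fun g => if g = g₁ then q₁ else -q₂, ?_, ?_, ?_⟩
    · intro x hx
      simp only [Finset.coe_insert, Finset.coe_singleton, Set.mem_insert_iff,
        Set.mem_singleton_iff] at hx
      rcases hx with rfl | rfl <;> assumption
    · rw [Finset.sum_pair e]
      simp only [if_true, if_neg (Ne.symm e), hS]; ring
    · intro g hg m hm
      refine ⟨B, hB, ?_⟩
      simp only [Finset.mem_insert, Finset.mem_singleton] at hg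
      rcases hg with rfl | rfl
      · simp only [if_true] at hm
        exact h₁ m hm.1
      · simp only [if_neg (Ne.symm e), neg_mul] at hm
        exact h₂ m (by simpa [MvPolynomial.mem_support_iff] using hm.1)

noncomputable def mono2 (u v : Pt) : Pt →₀ ℕ := Finsupp.single u 1 + Finsupp.single v 1

lemma XX (u v : Pt) : (X u * X v : MvPolynomial Pt K) = monomial (mono2 u v) 1 := by
  simp [X, mono2, monomial_mul]

lemma innerMinor_eq (u v : Pt) : innerMinor K u v =
    monomial (mono2 u v) 1 - monomial (mono2 (u.1, v.2) (v.1, u.2)) 1 := by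
  rw [innerMinor, XX, XX]

lemma mem_supp_binom {A B m : Pt →₀ ℕ}
    (h : m ∈ (monomial A (1 : K) - monomial B 1).support) : m = A ∨ m = B := by
  classical
  by_contra hcon
  push Not at hcon
  rw [mem_support_iff, coeff_sub, coeff_monomial, coeff_monomial, if_neg hcon.1.symm,
    if_neg hcon.2.symm] at h
  simp at h

lemma isLM_left {A B : Pt →₀ ℕ} (h : lexLt po B A) :
    IsLM po (monomial A (1 : K) - monomial B 1) A := by
  classical
  have hne : B ≠ A := by rintro rfl; exact lexLt_irrefl _ h
  refine ⟨by simp [hne, mem_support_iff], fun m hm => ?_⟩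
  rcases mem_supp_binom hm with rfl | rfl
  · exact Or.inl rfl
  · exact Or.inr h

lemma isLM_right {A B : Pt →₀ ℕ} (h : lexLt po A B) :
    IsLM po (monomial A (1 : K) - monomial B 1) B := by
  classical
  have hne : A ≠ B := by rintro rfl; exact lexLt_irrefl _ h
  refine ⟨by simp [hne, mem_support_iff], fun m hm => ?_⟩
  rcases mem_supp_binom hm with rfl | rfl
  · exact Or.inr h
  · exact Or.inl rfl

lemma lexLt_mono2 (hpo : IsStrictTotalOrder Pt po) {a b c d : Pt} (hac : a ≠ c) (had : a ≠ d)
    (hbc : b ≠ c) (hbd : b ≠ d) :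
    lexLt po (mono2 c d) (mono2 a b) ↔ (po c a ∧ po d a) ∨ (po c b ∧ po d b) := by
  classical
  have key : ∀ x, mono2 c d x = (if c = x then 1 else 0) + (if d = x then 1 else 0) := by
    intro x; simp [mono2, Finsupp.single_apply]
  have key' : ∀ x, mono2 a b x = (if a = x then 1 else 0) + (if b = x then 1 else 0) := by
    intro x; simp [mono2, Finsupp.single_apply]
  have irr : ∀ x, ¬ po x x := fun x => irrefl_of po x
  have tr : ∀ x y z, po x y → po y z → po x z := fun x y z => trans_of po
  have tri : ∀ x y, po x y ∨ x = y ∨ po y x := fun x y => trichotomous_of po x y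
  constructor
  · rintro ⟨w, hw, hmax⟩
    rw [key, key'] at hw
    have hwab : a = w ∨ b = w := by
      by_contra hcon
      push Not at hcon
      simp [hcon.1, hcon.2] at hw
    have hc : w ≠ c → po c w := by
      intro hne
      rcases tri c w with g | g | g
      · exact g
      · exact absurd g.symm hne
      · have := hmax c g
        rw [key, key', if_neg hac, if_neg hbc] at this
        simp at this
    have hd : w ≠ d → po d w := by
      intro hne
      rcases tri d w with g | g | g
      · exact g
      · exact absurd g.symm hne
      · have := hmax d g
        rw [key, key', if_neg had, if_neg hbd] at this
        simp at this
    rcases hwab with rfl | rfl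
    · exact Or.inl ⟨hc hac, hd had⟩
    · exact Or.inr ⟨hc hbc, hd hbd⟩
  · intro h
    have : ∃ w, (w = a ∨ w = b) ∧ po c w ∧ po d w ∧ ¬ po w a ∧ ¬ po w b := by
      rcases tri a b with g | g | g
      · refine ⟨b, Or.inr rfl, ?_, ?_, fun g' => irr _ (tr _ _ _ g g'), irr _⟩
        · rcases h with h | h
          · exact tr _ _ _ h.1 g
          · exact h.1
        · rcases h with h | h
          · exact tr _ _ _ h.2 g
          · exact h.2
      · subst g
        exact ⟨a, Or.inl rfl, by tauto, by tauto, irr _, irr _⟩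
      · refine ⟨a, Or.inl rfl, ?_, ?_, irr _, fun g' => irr _ (tr _ _ _ g g')⟩
        · rcases h with h | h
          · exact h.1
          · exact tr _ _ _ h.1 g
        · rcases h with h | h
          · exact h.2
          · exact tr _ _ _ h.2 g
    obtain ⟨w, hw, h1, h2, h3, h4⟩ := this
    have hcw : c ≠ w := by rintro rfl; exact irr _ h1
    have hdw : d ≠ w := by rintro rfl; exact irr _ h2
    refine ⟨w, ?_, fun y hy => ?_⟩
    · rw [key, key', if_neg hcw, if_neg hdw]
      rcases hw with rfl | rfl <;> simp
    · have e1 : a ≠ y := by rintro rfl; exact h3 hy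
      have e2 : b ≠ y := by rintro rfl; exact h4 hy
      have e3 : c ≠ y := by rintro rfl; exact irr _ (tr _ _ _ h1 hy)
      have e4 : d ≠ y := by rintro rfl; exact irr _ (tr _ _ _ h2 hy)
      rw [key, key', if_neg e1, if_neg e2, if_neg e3, if_neg e4]

lemma mem_of_le {u v x y z : Pt} (h : mono2 u v ≤ mono3 x y z) :
    (u = x ∨ u = y ∨ u = z) ∧ (v = x ∨ v = y ∨ v = z) := by
  classical
  constructor
  · have := h u
    by_contra hcon
    push Not at hcon
    simp [mono2, mono3, Finsupp.single_apply, hcon.1.symm, hcon.2.1.symm, hcon.2.2.symm] at this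
  · have := h v
    by_contra hcon
    push Not at hcon
    simp [mono2, mono3, Finsupp.single_apply, hcon.1.symm, hcon.2.1.symm, hcon.2.2.symm] at this

lemma supp_X_minor {w u v : Pt} {m : Pt →₀ ℕ} (h : m ∈ (X w * innerMinor K u v).support) :
    m = mono2 u v + Finsupp.single w 1 ∨
      m = mono2 (u.1, v.2) (v.1, u.2) + Finsupp.single w 1 := by
  rw [innerMinor_eq, X, mul_sub, monomial_mul, monomial_mul, mul_one] at h
  rw [add_comm (mono2 u v), add_comm (mono2 _ _)]
  exact mem_supp_binom h

/-- leading monomial of an inner minor -/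
lemma isLM_minor (hpo : IsStrictTotalOrder Pt po) {u v : Pt} {m : Pt →₀ ℕ}
    (h : IsLM po (innerMinor K u v) m) :
    (m = mono2 u v ∧ lexLt po (mono2 (u.1, v.2) (v.1, u.2)) (mono2 u v)) ∨
    (m = mono2 (u.1, v.2) (v.1, u.2) ∧ lexLt po (mono2 u v) (mono2 (u.1, v.2) (v.1, u.2))) := by
  rw [innerMinor_eq] at h
  rcases lexLt_total hpo (mono2 u v) (mono2 (u.1, v.2) (v.1, u.2)) with g | g | g
  · exact Or.inr ⟨isLM_unique hpo h (isLM_right g), g⟩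
  · exfalso
    have := h.1
    rw [g, sub_self] at this
    simp at this
  · exact Or.inl ⟨isLM_unique hpo h (isLM_left g), g⟩

lemma corners_iff {P : Finset Pt} {x y x' y' : ℤ} (hx : x < x') (hy : y < y') (s : Finset Pt)
    (hs : s = {(x, y), (x', y'), (x, y'), (x', y)}) :
    (∃ u v : Pt, IsInnerInterval P u v ∧ cornersOf u v = s) ↔
      IsInnerInterval P (x, y) (x', y') := by
  subst hs
  constructor
  · rintro ⟨⟨u1, u2⟩, ⟨v1, v2⟩, h, hc⟩
    have hu : ((u1, u2) : Pt) ∈ cornersOf (u1, u2) (v1, v2) := by simp [cornersOf]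
    have hv : ((v1, v2) : Pt) ∈ cornersOf (u1, u2) (v1, v2) := by simp [cornersOf]
    rw [hc] at hu hv
    simp only [Finset.mem_insert, Finset.mem_singleton, Prod.mk.injEq] at hu hv
    have h1 : u1 < v1 := h.1
    have h2 : u2 < v2 := h.2.1
    have : u1 = x ∧ u2 = y ∧ v1 = x' ∧ v2 = y' := by omega
    obtain ⟨rfl, rfl, rfl, rfl⟩ := this
    exact h
  · intro h
    exact ⟨_, _, h, rfl⟩


lemma pos_mono2 {u v w : Pt} (h : 0 < mono2 u v w) : w = u ∨ w = v := by
  classical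
  by_contra hcon
  push Not at hcon
  simp [mono2, Finsupp.single_apply, hcon.1.symm, hcon.2.symm] at h

lemma sup_sub_left {a b e : Pt} (hab : a ≠ b) (hbe : b ≠ e) (hae : a ≠ e) :
    mono2 a b ⊔ mono2 b e - mono2 a b = Finsupp.single e 1 := by
  classical
  ext x
  simp only [mono2, Finsupp.coe_tsub, Finsupp.sup_apply, Finsupp.add_apply, Pi.sub_apply,
    Finsupp.single_apply]
  split_ifs <;> simp_all

lemma sup_sub_right {a b e : Pt} (hab : a ≠ b) (hbe : b ≠ e) (hae : a ≠ e) :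
    mono2 a b ⊔ mono2 b e - mono2 b e = Finsupp.single a 1 := by
  classical
  ext x
  simp only [mono2, Finsupp.coe_tsub, Finsupp.sup_apply, Finsupp.add_apply, Pi.sub_apply,
    Finsupp.single_apply]
  split_ifs <;> simp_all

lemma coeff_left {A B : Pt →₀ ℕ} (h : lexLt po B A) :
    (monomial A (1 : K) - monomial B 1).coeff A = 1 := by
  classical
  have hne : B ≠ A := by rintro rfl; exact lexLt_irrefl _ h
  simp [hne, coeff_monomial]

lemma XXX (u v w : Pt) : (X u * X v * X w : MvPolynomial Pt K) = monomial (mono3 u v w) 1 := by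
  simp [X, mono3, monomial_mul]

lemma isSPoly_iff (hpo : IsStrictTotalOrder Pt po) {i j k l p q : ℤ}
    (hik : i < k) (hjl : j < l) (hkp : k < p) (hlq : l < q)
    (hf : lexLt po (mono2 (i, l) (k, j)) (mono2 (i, j) (k, l)))
    (hg : lexLt po (mono2 (k, q) (p, l)) (mono2 (k, l) (p, q))) (sp : MvPolynomial Pt K) :
    IsSPoly po (innerMinor K (i, j) (k, l)) (innerMinor K (k, l) (p, q)) sp ↔
      sp = monomial (mono3 (i, j) (k, q) (p, l)) 1 - monomial (mono3 (p, q) (k, j) (i, l)) 1 := by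
  have e1 : ((i, j) : Pt) ≠ (k, l) := by simp; omega
  have e2 : ((k, l) : Pt) ≠ (p, q) := by simp; omega
  have e3 : ((i, j) : Pt) ≠ (p, q) := by simp; omega
  have lf : IsLM po (innerMinor K (i, j) (k, l)) (mono2 (i, j) (k, l)) := by
    rw [innerMinor_eq]; exact isLM_left hf
  have lg : IsLM po (innerMinor K (k, l) (p, q)) (mono2 (k, l) (p, q)) := by
    rw [innerMinor_eq]; exact isLM_left hg
  have cf : (innerMinor K (i, j) (k, l)).coeff (mono2 (i, j) (k, l)) = 1 := by
    rw [innerMinor_eq]; exact coeff_left hf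
  have cg : (innerMinor K (k, l) (p, q)).coeff (mono2 (k, l) (p, q)) = 1 := by
    rw [innerMinor_eq]; exact coeff_left hg
  have main : monomial (mono2 (i, j) (k, l) ⊔ mono2 (k, l) (p, q) - mono2 (i, j) (k, l))
        ((innerMinor K (i, j) (k, l)).coeff (mono2 (i, j) (k, l)))⁻¹ * innerMinor K (i, j) (k, l)
      - monomial (mono2 (i, j) (k, l) ⊔ mono2 (k, l) (p, q) - mono2 (k, l) (p, q))
        ((innerMinor K (k, l) (p, q)).coeff (mono2 (k, l) (p, q)))⁻¹ * innerMinor K (k, l) (p, q)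
      = monomial (mono3 (i, j) (k, q) (p, l)) 1 - monomial (mono3 (p, q) (k, j) (i, l)) 1 := by
    rw [cf, cg, sup_sub_left e1 e2 e3, sup_sub_right e1 e2 e3, inv_one, ← XXX, ← XXX]
    change X (p, q) * _ - X (i, j) * _ = _
    simp only [innerMinor]
    ring
  constructor
  · rintro ⟨mf, mg, h1, h2, rfl⟩
    rw [isLM_unique hpo h1 lf, isLM_unique hpo h2 lg]
    exact main
  · rintro rfl
    exact ⟨_, _, lf, lg, main.symm⟩

lemma inner_h {P : Finset Pt} {x x' x'' y y' : ℤ} (h : IsInnerInterval P (x, y) (x', y'))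
    (h' : IsInnerInterval P (x', y) (x'', y')) : IsInnerInterval P (x, y) (x'', y') := by
  refine ⟨h.1.trans h'.1, h.2.1, fun c h1 h2 h3 h4 => ?_⟩
  rcases lt_or_ge c.1 x' with g | g
  · exact h.2.2 c h1 g h3 h4
  · exact h'.2.2 c g h2 h3 h4

lemma inner_v {P : Finset Pt} {x x' y y' y'' : ℤ} (h : IsInnerInterval P (x, y) (x', y'))
    (h' : IsInnerInterval P (x, y') (x', y'')) : IsInnerInterval P (x, y) (x', y'') := by
  refine ⟨h.1, h.2.1.trans h'.2.1, fun c h1 h2 h3 h4 => ?_⟩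
  rcases lt_or_ge c.2 y' with g | g
  · exact h.2.2 c h1 h2 h3 g
  · exact h'.2.2 c h1 h2 g h4

lemma inner_sub {P : Finset Pt} {x x' y y' u u' v v' : ℤ} (h : IsInnerInterval P (x, y) (x', y'))
    (h1 : u < u') (h2 : v < v') (h3 : x ≤ u) (h4 : u' ≤ x') (h5 : y ≤ v) (h6 : v' ≤ y') :
    IsInnerInterval P (u, v) (u', v') :=
  ⟨h1, h2, fun c g1 g2 g3 g4 => h.2.2 c (h3.trans g1) (g2.trans_le h4) (h5.trans g3)
    (g4.trans_le h6)⟩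

lemma bound_X_minor {w u v : Pt} {B : Pt →₀ ℕ}
    (h1 : lexLe po (mono2 u v + Finsupp.single w 1) B)
    (h2 : lexLe po (mono2 (u.1, v.2) (v.1, u.2) + Finsupp.single w 1) B) :
    ∀ m ∈ (X w * innerMinor K u v).support, lexLe po m B := by
  intro m hm
  rcases supp_X_minor hm with rfl | rfl <;> assumption

end helpers

theorem sPoly_reducesToZero_iff_case5
    (K : Type*) [Field K] (P : Finset Pt) (hP : P.Nonempty)
    (i j k l p q : ℤ)
    (a b c d α β γ δ h r : Pt)
    (ha : a = (i, j)) (hb : b = (k, l)) (hc : c = (i, l)) (hd : d = (k, j))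
    (hα : α = b) (hβ : β = (p, q)) (hγ : γ = (k, q)) (hδ : δ = (p, l))
    (hh : h = (p, j)) (hr : r = (i, q))
    (hik : i < k) (hjl : j < l) (hkp : k < p) (hlq : l < q)
    (hab : IsInnerInterval P a b) (hαβ : IsInnerInterval P α β)
    (po : Pt → Pt → Prop) (hpo : IsStrictTotalOrder Pt po)
    (hgcd : ∃ mf mg : Pt →₀ ℕ, IsLM po (innerMinor K a b) mf ∧
      IsLM po (innerMinor K α β) mg ∧ ∃ w, 0 < mf w ∧ 0 < mg w) :
    (∀ sp, IsSPoly po (innerMinor K a b) (innerMinor K α β) sp →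
        ReducesToZero po (minorsSet K P) sp) ↔
      ((lexLt po (mono3 a γ δ) (mono3 β d c) ∧
          (∃ u v : Pt, IsInnerInterval P u v ∧ cornersOf u v = ({d, δ, b, h} : Finset Pt)) ∧
          ((po h β ∧ po γ β) ∨ (po h d ∧ po γ d))) ∨
       (lexLt po (mono3 a γ δ) (mono3 β d c) ∧
          (∃ u v : Pt, IsInnerInterval P u v ∧ cornersOf u v = ({c, γ, b, r} : Finset Pt)) ∧
          ((po r β ∧ po δ β) ∨ (po r c ∧ po δ c))) ∨
       (lexLt po (mono3 β d c) (mono3 a γ δ) ∧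
          (∃ u v : Pt, IsInnerInterval P u v ∧ cornersOf u v = ({c, γ, b, r} : Finset Pt)) ∧
          ((po r a ∧ po d a) ∨ (po r γ ∧ po d γ))) ∨
       (lexLt po (mono3 β d c) (mono3 a γ δ) ∧
          (∃ u v : Pt, IsInnerInterval P u v ∧ cornersOf u v = ({d, δ, b, h} : Finset Pt)) ∧
          ((po c a ∧ po h a) ∨ (po c δ ∧ po h δ)))) := by
  subst ha hb hc hd hα hβ hγ hδ hh hr
  have hfg : lexLt po (mono2 (i, l) (k, j)) (mono2 (i, j) (k, l)) ∧
      lexLt po (mono2 (k, q) (p, l)) (mono2 (k, l) (p, q)) := by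
    obtain ⟨mf, mg, h1, h2, ⟨w1, w2⟩, h3, h4⟩ := hgcd
    rcases isLM_minor hpo h1 with ⟨rfl, g1⟩ | ⟨rfl, g1⟩ <;>
    rcases isLM_minor hpo h2 with ⟨rfl, g2⟩ | ⟨rfl, g2⟩
    · exact ⟨g1, g2⟩
    all_goals
      exfalso
      have h3 := pos_mono2 h3
      have h4 := pos_mono2 h4
      simp only [Prod.mk.injEq] at h3 h4
      omega
  obtain ⟨hf, hg⟩ := hfg
  simp only [isSPoly_iff hpo hik hjl hkp hlq hf hg, forall_eq]
  rw [corners_iff hkp hjl _ rfl, corners_iff hik hlq {(i, l), (k, q), (k, l), (i, q)} (by ext x; simp; tauto)]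
  have n1 : lexLt po (mono2 (k, q) (p, j)) (mono2 (k, j) (p, q)) ↔
      ((po (p, j) (p, q) ∧ po (k, q) (p, q)) ∨ (po (p, j) (k, j) ∧ po (k, q) (k, j))) := by
    rw [lexLt_mono2 hpo (by simp; omega) (by simp; omega) (by simp; omega) (by simp; omega)]
    tauto
  have n2 : lexLt po (mono2 (i, q) (p, l)) (mono2 (i, l) (p, q)) ↔
      ((po (i, q) (p, q) ∧ po (p, l) (p, q)) ∨ (po (i, q) (i, l) ∧ po (p, l) (i, l))) := by
    rw [lexLt_mono2 hpo (by simp; omega) (by simp; omega) (by simp; omega) (by simp; omega)]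
    tauto
  have n3 : lexLt po (mono2 (i, q) (k, j)) (mono2 (i, j) (k, q)) ↔
      ((po (i, q) (i, j) ∧ po (k, j) (i, j)) ∨ (po (i, q) (k, q) ∧ po (k, j) (k, q))) := by
    rw [lexLt_mono2 hpo (by simp; omega) (by simp; omega) (by simp; omega) (by simp; omega)]
  have n4 : lexLt po (mono2 (i, l) (p, j)) (mono2 (i, j) (p, l)) ↔
      ((po (i, l) (i, j) ∧ po (p, j) (i, j)) ∨ (po (i, l) (p, l) ∧ po (p, j) (p, l))) := by
    rw [lexLt_mono2 hpo (by simp; omega) (by simp; omega) (by simp; omega) (by simp; omega)]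
  rw [← n1, ← n2, ← n3, ← n4]
  constructor
  · intro hred
    rcases lexLt_total hpo (mono3 (i, j) (k, q) (p, l)) (mono3 (p, q) (k, j) (i, l)) with g | g | g
    · obtain ⟨_, ⟨⟨u1, u2⟩, ⟨v1, v2⟩, huv, rfl⟩, m, hm, hle⟩ :=
        exists_div hpo (isLM_right (K := K) g) hred
      have o1 : u1 < v1 := huv.1
      have o2 : u2 < v2 := huv.2.1
      rcases isLM_minor hpo hm with ⟨rfl, g1⟩ | ⟨rfl, g1⟩
      · have hx := mem_of_le hle
        simp only [Prod.mk.injEq] at hx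
        have : (u1 = k ∧ u2 = j ∧ v1 = p ∧ v2 = q) ∨ (u1 = i ∧ u2 = l ∧ v1 = p ∧ v2 = q) := by
          omega
        rcases this with ⟨rfl, rfl, rfl, rfl⟩ | ⟨rfl, rfl, rfl, rfl⟩
        · exact Or.inl ⟨g, inner_sub huv hkp hjl le_rfl le_rfl le_rfl hlq.le, g1⟩
        · exact Or.inr (Or.inl ⟨g, inner_sub huv hik hlq le_rfl hkp.le le_rfl le_rfl, g1⟩)
      · exfalso
        have hx := mem_of_le hle
        simp only [Prod.mk.injEq] at hx
        have : u1 = i ∧ u2 = j ∧ v1 = k ∧ v2 = l := by omega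
        obtain ⟨rfl, rfl, rfl, rfl⟩ := this
        exact lexLt_irrefl _ (lexLt_trans hpo hf g1)
    · exfalso
      have hx : mono2 (i, j) (k, q) ≤ mono3 (p, q) (k, j) (i, l) := by
        rw [← g]; exact le_self_add
      have hx := mem_of_le hx
      simp only [Prod.mk.injEq] at hx
      omega
    · obtain ⟨_, ⟨⟨u1, u2⟩, ⟨v1, v2⟩, huv, rfl⟩, m, hm, hle⟩ :=
        exists_div hpo (isLM_left (K := K) g) hred
      have o1 : u1 < v1 := huv.1
      have o2 : u2 < v2 := huv.2.1
      rcases isLM_minor hpo hm with ⟨rfl, g1⟩ | ⟨rfl, g1⟩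
      · have hx := mem_of_le hle
        simp only [Prod.mk.injEq] at hx
        have : (u1 = i ∧ u2 = j ∧ v1 = k ∧ v2 = q) ∨ (u1 = i ∧ u2 = j ∧ v1 = p ∧ v2 = l) := by
          omega
        rcases this with ⟨rfl, rfl, rfl, rfl⟩ | ⟨rfl, rfl, rfl, rfl⟩
        · exact Or.inr (Or.inr (Or.inl
            ⟨g, inner_sub huv hik hlq le_rfl le_rfl hjl.le le_rfl, g1⟩))
        · exact Or.inr (Or.inr (Or.inr
            ⟨g, inner_sub huv hkp hjl hik.le le_rfl le_rfl le_rfl, g1⟩))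
      · exfalso
        have hx := mem_of_le hle
        simp only [Prod.mk.injEq] at hx
        have : u1 = k ∧ u2 = l ∧ v1 = p ∧ v2 = q := by omega
        obtain ⟨rfl, rfl, rfl, rfl⟩ := this
        exact lexLt_irrefl _ (lexLt_trans hpo hg g1)
  · have s1 : (monomial (mono3 (i, j) (k, q) (p, l)) 1 - monomial (mono3 (p, q) (k, j) (i, l)) 1 :
        MvPolynomial Pt K) =
        X (k, q) * innerMinor K (i, j) (p, l) - X (i, l) * innerMinor K (k, j) (p, q) := by
      rw [← XXX, ← XXX]; simp only [innerMinor]; ring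
    have s2 : (monomial (mono3 (i, j) (k, q) (p, l)) 1 - monomial (mono3 (p, q) (k, j) (i, l)) 1 :
        MvPolynomial Pt K) =
        X (p, l) * innerMinor K (i, j) (k, q) - X (k, j) * innerMinor K (i, l) (p, q) := by
      rw [← XXX, ← XXX]; simp only [innerMinor]; ring
    have t1 : mono2 (i, j) (p, l) + Finsupp.single (k, q) 1 = mono3 (i, j) (k, q) (p, l) := by
      simp only [mono2, mono3]; abel
    have t2 : mono2 (k, j) (p, q) + Finsupp.single (i, l) 1 = mono3 (p, q) (k, j) (i, l) := by
      simp only [mono2, mono3]; abel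
    have t3 : mono2 (i, l) (p, j) + Finsupp.single (k, q) 1 =
        mono2 (k, q) (p, j) + Finsupp.single (i, l) 1 := by
      simp only [mono2]; abel
    have t4 : mono2 (i, j) (k, q) + Finsupp.single (p, l) 1 = mono3 (i, j) (k, q) (p, l) := by
      simp only [mono2, mono3]
    have t5 : mono2 (i, l) (p, q) + Finsupp.single (k, j) 1 = mono3 (p, q) (k, j) (i, l) := by
      simp only [mono2, mono3]; abel
    have t6 : mono2 (i, q) (k, j) + Finsupp.single (p, l) 1 =
        mono2 (i, q) (p, l) + Finsupp.single (k, j) 1 := by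
      simp only [mono2]; abel
    have A : ∀ B, IsLM po (monomial (mono3 (i, j) (k, q) (p, l)) 1 -
          monomial (mono3 (p, q) (k, j) (i, l)) 1 : MvPolynomial Pt K) B →
        lexLe po (mono3 (i, j) (k, q) (p, l)) B → lexLe po (mono3 (p, q) (k, j) (i, l)) B →
        lexLt po (mono2 (k, q) (p, j) + Finsupp.single (i, l) 1) B →
        IsInnerInterval P (k, j) (p, l) →
        ReducesToZero po (minorsSet K P) (monomial (mono3 (i, j) (k, q) (p, l)) 1 -
          monomial (mono3 (p, q) (k, j) (i, l)) 1 : MvPolynomial Pt K) := by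
      intro B hB b1 b2 b3 hI
      refine reduces_of hB ⟨_, _, inner_h hab hI, rfl⟩ ⟨_, _, inner_v hI hαβ, rfl⟩ s1
        (bound_X_minor ?_ ?_) (bound_X_minor ?_ ?_)
      · rw [t1]; exact b1
      · exact Or.inr (t3 ▸ b3)
      · rw [t2]; exact b2
      · exact Or.inr b3
    have A' : ∀ B, IsLM po (monomial (mono3 (i, j) (k, q) (p, l)) 1 -
          monomial (mono3 (p, q) (k, j) (i, l)) 1 : MvPolynomial Pt K) B →
        lexLe po (mono3 (i, j) (k, q) (p, l)) B → lexLe po (mono3 (p, q) (k, j) (i, l)) B →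
        lexLt po (mono2 (i, q) (p, l) + Finsupp.single (k, j) 1) B →
        IsInnerInterval P (i, l) (k, q) →
        ReducesToZero po (minorsSet K P) (monomial (mono3 (i, j) (k, q) (p, l)) 1 -
          monomial (mono3 (p, q) (k, j) (i, l)) 1 : MvPolynomial Pt K) := by
      intro B hB b1 b2 b3 hI
      refine reduces_of hB ⟨_, _, inner_v hab hI, rfl⟩ ⟨_, _, inner_h hI hαβ, rfl⟩ s2
        (bound_X_minor ?_ ?_) (bound_X_minor ?_ ?_)
      · rw [t4]; exact b1
      · exact Or.inr (t6 ▸ b3)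
      · rw [t5]; exact b2
      · exact Or.inr b3
    rintro (⟨g, hI, g1⟩ | ⟨g, hI, g1⟩ | ⟨g, hI, g1⟩ | ⟨g, hI, g1⟩)
    · exact A _ (isLM_right g) (Or.inr g) (Or.inl rfl) (t2 ▸ lexLt_add _ g1) hI
    · exact A' _ (isLM_right g) (Or.inr g) (Or.inl rfl) (t5 ▸ lexLt_add _ g1) hI
    · exact A' _ (isLM_left g) (Or.inl rfl) (Or.inr g) (t6 ▸ t4 ▸ lexLt_add _ g1) hI
    · exact A _ (isLM_left g) (Or.inl rfl) (Or.inr g) (t3 ▸ t1 ▸ lexLt_add _ g1) hI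

end ClosedPathPaper
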